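/- arXiv:0712.2246 — 2 statements merged into one kernel-verified Lean document; each statement's English description precedes it below -/
import Mathlib

section
/- Let P = {P_1,…,P_m} and Q = {Q_1,…,Q_t} be systems of coordinate projections in M_n(ℂ) such that P refines Q, i.e., there is a partition {D(1),…,D(t)} of {1,…,m} into consecutive blocks with Q_k = Σ_{i∈D(k)} P_i for each k. Then: (1) for hermitian A, B ∈ M_n(ℂ), if there exist unitaries U, V ∈ U(n) with V*AV = C_Q(U*BU), then there exist unitaries U', V' ∈ U(n) with V'*AV' = C_P(U'*BU'); (2) for positive semidefinite A, B ∈ M_n(ℂ), if there exist a unitary V ∈ U(n) and a contraction W ∈ M_n(ℂ) with V*AV = C_Q(W*BW), then there exist a unitary V' and a contraction W' with V'*AV' = C_P(W'*BW'). -/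
open Matrix
open scoped ComplexOrder

/-- `V` is a contraction: its operator norm on `ℓ²` is at most 1. -/
noncomputable def IsContraction {ι : Type*} [Fintype ι] [DecidableEq ι]
    (V : Matrix ι ι ℂ) : Prop :=
  ∀ x : EuclideanSpace ℂ ι, ‖Matrix.toEuclideanLin V x‖ ≤ ‖x‖

/-- The `i`-th coordinate projection of the system encoded by the block-index
function `g : Fin n → Fin m` (monotone and surjective `g` corresponds to a
partition of `{1,…,n}` into `m` consecutive intervals). -/
def coordProj {n m : ℕ} (g : Fin n → Fin m) (i : Fin m) :
    Matrix (Fin n) (Fin n) ℂ :=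
  Matrix.diagonal fun k => if g k = i then 1 else 0

/-- The compression `C_P(X) = Σ_i P_i X P_i` induced by the system of
coordinate projections encoded by `g`. -/
noncomputable def coordCompress {n m : ℕ} (g : Fin n → Fin m)
    (X : Matrix (Fin n) (Fin n) ℂ) : Matrix (Fin n) (Fin n) ℂ :=
  ∑ i : Fin m, coordProj g i * X * coordProj g i

/-- The nonincreasing rearrangement `x↓` of a vector `x ∈ ℝ^n`. -/
noncomputable def sortedVec {n : ℕ} (x : Fin n → ℝ) : Fin n → ℝ :=
  fun i => ((Multiset.map x Finset.univ.val).sort (· ≥ ·)).get (Fin.cast (by simp) i)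

/-- Vector majorization `x ≺ y`. -/
noncomputable def Majorizes {n : ℕ} (x y : Fin n → ℝ) : Prop :=
  (∀ k : ℕ, k ≤ n →
      ∑ i ∈ Finset.univ.filter (fun i : Fin n => (i : ℕ) < k), sortedVec x i ≤
        ∑ i ∈ Finset.univ.filter (fun i : Fin n => (i : ℕ) < k), sortedVec y i) ∧
    ∑ i, x i = ∑ i, y i

/-- `f(A)` for a hermitian matrix `A`, via the spectral theorem. -/
noncomputable def matFun {n : ℕ} {A : Matrix (Fin n) (Fin n) ℂ}
    (hA : A.IsHermitian) (f : ℝ → ℝ) : Matrix (Fin n) (Fin n) ℂ :=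
  (hA.eigenvectorUnitary : Matrix (Fin n) (Fin n) ℂ) *
    Matrix.diagonal (fun i => (f (hA.eigenvalues i) : ℂ)) *
    star (hA.eigenvectorUnitary : Matrix (Fin n) (Fin n) ℂ)

theorem coordCompress_apply {n m : ℕ} (g : Fin n → Fin m) (X : Matrix (Fin n) (Fin n) ℂ)
    (i j : Fin n) : coordCompress g X i j = if g i = g j then X i j else 0 := by
  simp only [coordCompress, coordProj, Matrix.sum_apply, Matrix.mul_diagonal,
    Matrix.diagonal_mul]
  rw [Finset.sum_eq_single (g i)]
  · simp [eq_comm]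
  · intro b _ hb
    simp [hb.symm]
  · simp

/-- Compressing by a coarser system first does not change the compression by a finer one. -/
theorem coordCompress_coordCompress_comp {n m t : ℕ} (g : Fin n → Fin m) (f : Fin m → Fin t)
    (X : Matrix (Fin n) (Fin n) ℂ) :
    coordCompress g (coordCompress (f ∘ g) X) = coordCompress g X := by
  ext i j
  simp only [coordCompress_apply, Function.comp_apply]
  split_ifs with h h'
  · rfl
  · exact absurd (congrArg f h) h'
  · rfl

theorem coordCompress_of_isDiag {n m : ℕ} (g : Fin n → Fin m) {X : Matrix (Fin n) (Fin n) ℂ}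
    (hX : X.IsDiag) : coordCompress g X = X := by
  ext i j
  rw [coordCompress_apply]
  split_ifs with h
  · rfl
  · exact (hX fun hij => h (congrArg g hij)).symm

theorem commute_coordProj {n m : ℕ} {g : Fin n → Fin m} {R : Matrix (Fin n) (Fin n) ℂ}
    (hR : ∀ i j, g i ≠ g j → R i j = 0) (k : Fin m) : Commute (coordProj g k) R := by
  ext i j
  simp only [coordProj, Matrix.mul_diagonal, Matrix.diagonal_mul]
  by_cases h : g i = g j
  · simp [h]
  · simp [hR i j h]

/-- Conjugation by a block diagonal matrix commutes with the compression. -/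
theorem coordCompress_conj {n m : ℕ} {g : Fin n → Fin m} {R : Matrix (Fin n) (Fin n) ℂ}
    (hR : ∀ i j, g i ≠ g j → R i j = 0) (X : Matrix (Fin n) (Fin n) ℂ) :
    coordCompress g (Rᴴ * X * R) = Rᴴ * coordCompress g X * R := by
  have hR' : ∀ i j, g i ≠ g j → Rᴴ i j = 0 := fun i j h => by
    rw [Matrix.conjTranspose_apply, hR j i h.symm, star_zero]
  simp only [coordCompress, Finset.mul_sum, Finset.sum_mul]
  refine Finset.sum_congr rfl fun k _ => ?_
  have h1 := (commute_coordProj hR k).eq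
  have h2 := (commute_coordProj hR' k).eq
  calc coordProj g k * (Rᴴ * X * R) * coordProj g k
      = (coordProj g k * Rᴴ) * X * (R * coordProj g k) := by simp only [Matrix.mul_assoc]
    _ = Rᴴ * (coordProj g k * X * coordProj g k) * R := by
      rw [h2, ← h1]; simp only [Matrix.mul_assoc]

/-- A block diagonal hermitian matrix is diagonalized by a block diagonal unitary. -/
theorem exists_blockDiag_unitary_isDiag {n m : ℕ} (g : Fin n → Fin m)
    {M : Matrix (Fin n) (Fin n) ℂ} (hM : M.IsHermitian)
    (hblock : ∀ i j, g i ≠ g j → M i j = 0) :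
    ∃ R ∈ Matrix.unitaryGroup (Fin n) ℂ,
      (∀ i j, g i ≠ g j → R i j = 0) ∧ (Rᴴ * M * R).IsDiag := by
  let e := Equiv.sigmaFiberEquiv g
  let N : ∀ k, Matrix {i // g i = k} {i // g i = k} ℂ := fun k => M.submatrix (↑) (↑)
  have hN : ∀ k, (N k).IsHermitian := fun k => hM.submatrix _
  let U : ∀ k, Matrix {i // g i = k} {i // g i = k} ℂ := fun k => (hN k).eigenvectorUnitary
  have hU : ∀ k, (U k)ᴴ * U k = 1 := fun k =>
    Matrix.mem_unitaryGroup_iff'.mp (hN k).eigenvectorUnitary.2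
  have hUN : ∀ k, (U k)ᴴ * N k * U k =
      Matrix.diagonal fun i => ((hN k).eigenvalues i : ℂ) := fun k => by
    simpa [Unitary.conjStarAlgAut_apply, Matrix.star_eq_conjTranspose, Function.comp_def]
      using (hN k).conjStarAlgAut_star_eigenvectorUnitary
  have hMN : M = (Matrix.blockDiagonal' N).submatrix e.symm e.symm := by
    rw [← Matrix.submatrix_id_id M, ← e.self_comp_symm, ← Matrix.submatrix_submatrix]
    congr 1
    ext ⟨k, i⟩ ⟨l, j⟩
    by_cases h : k = l
    · subst h
      simp [Matrix.blockDiagonal'_apply_eq, N, e]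
    · rw [Matrix.blockDiagonal'_apply_ne _ _ _ h]
      exact hblock _ _ (by simpa [e, i.2, j.2] using h)
  refine ⟨(Matrix.blockDiagonal' U).submatrix e.symm e.symm, ?_, ?_, ?_⟩
  · rw [Matrix.mem_unitaryGroup_iff', Matrix.star_eq_conjTranspose,
      Matrix.conjTranspose_submatrix, Matrix.submatrix_mul_equiv,
      Matrix.blockDiagonal'_conjTranspose, ← Matrix.blockDiagonal'_mul]
    simp only [hU]
    rw [show (Matrix.blockDiagonal' fun k => (1 : Matrix {i // g i = k} {i // g i = k} ℂ)) = 1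
      from Matrix.blockDiagonal'_one, Matrix.submatrix_one_equiv]
  · intro i j h
    exact Matrix.blockDiagonal'_apply_ne U (e.symm i).2 (e.symm j).2 h
  · rw [hMN, Matrix.conjTranspose_submatrix, Matrix.submatrix_mul_equiv,
      Matrix.submatrix_mul_equiv, Matrix.blockDiagonal'_conjTranspose,
      ← Matrix.blockDiagonal'_mul, ← Matrix.blockDiagonal'_mul]
    simp only [hUN]
    rw [Matrix.blockDiagonal'_diagonal]
    exact (Matrix.isDiag_diagonal _).submatrix e.symm.injective

/-- A hermitian compression by a coarser system is, up to unitary conjugation, a compression by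
a finer one. -/
theorem exists_unitary_conj_eq_coordCompress {n m t : ℕ} (g : Fin n → Fin m)
    (f : Fin m → Fin t) {M X : Matrix (Fin n) (Fin n) ℂ} (hM : M.IsHermitian)
    (h : M = coordCompress (f ∘ g) X) :
    ∃ R ∈ Matrix.unitaryGroup (Fin n) ℂ, Rᴴ * M * R = coordCompress g (Rᴴ * X * R) := by
  obtain ⟨R, hR, hRg, hdiag⟩ := exists_blockDiag_unitary_isDiag (f ∘ g) hM fun i j hij => by
    rw [h, coordCompress_apply, if_neg hij]
  refine ⟨R, hR, ?_⟩
  rw [← coordCompress_coordCompress_comp g f, coordCompress_conj hRg, ← h,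
    coordCompress_of_isDiag g hdiag]

theorem isContraction_of_mem_unitaryGroup {ι : Type*} [Fintype ι] [DecidableEq ι]
    {R : Matrix ι ι ℂ} (hR : R ∈ Matrix.unitaryGroup ι ℂ) : IsContraction R := fun x => by
  have hadj : LinearMap.adjoint (Matrix.toEuclideanLin R) * Matrix.toEuclideanLin R = 1 := by
    rw [← Matrix.toEuclideanLin_conjTranspose_eq_adjoint]
    ext1 y
    rw [Module.End.mul_apply, ← LinearMap.comp_apply, Matrix.toEuclideanLin,
      ← Matrix.toLpLin_mul_same, ← Matrix.star_eq_conjTranspose,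
      Matrix.mem_unitaryGroup_iff'.mp hR, Matrix.toLpLin_one]
    rfl
  refine le_of_eq ?_
  rw [@norm_eq_sqrt_re_inner ℂ, @norm_eq_sqrt_re_inner ℂ _ _ _ _ x,
    ← LinearMap.adjoint_inner_left]
  exact congrArg (fun y => √(RCLike.re (inner ℂ y x))) (LinearMap.congr_fun hadj x)

theorem IsContraction.mul {ι : Type*} [Fintype ι] [DecidableEq ι] {V W : Matrix ι ι ℂ}
    (hV : IsContraction V) (hW : IsContraction W) : IsContraction (V * W) := fun x => by
  have h : Matrix.toEuclideanLin (V * W) x =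
      Matrix.toEuclideanLin V (Matrix.toEuclideanLin W x) := by
    simp [Matrix.toEuclideanLin]
  rw [h]
  exact (hV _).trans (hW x)

/-- refinement of coordinate systems: `𝒍₂`-(sub)majorization
implies `𝒍₁`-(sub)majorization.  The systems of coordinate projections are
encoded by monotone surjective block-index functions `g : Fin n → Fin m` (for
`P`) and `g' : Fin n → Fin t` (for `Q`); `P` refines `Q` exactly when
`g' = f ∘ g` for a (necessarily monotone) `f : Fin m → Fin t`, i.e.
`Q_k = Σ_{i ∈ f⁻¹(k)} P_i`. -/
theorem stmt_9 {n m t : ℕ} (g : Fin n → Fin m) (hg_mono : Monotone g)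
    (hg_surj : Function.Surjective g)
    (g' : Fin n → Fin t) (hg'_mono : Monotone g')
    (hg'_surj : Function.Surjective g')
    (f : Fin m → Fin t) (hf_mono : Monotone f) (href : g' = f ∘ g) :
    (∀ A B : Matrix (Fin n) (Fin n) ℂ, A.IsHermitian → B.IsHermitian →
      (∃ U ∈ Matrix.unitaryGroup (Fin n) ℂ, ∃ V ∈ Matrix.unitaryGroup (Fin n) ℂ,
        Vᴴ * A * V = coordCompress g' (Uᴴ * B * U)) →
      (∃ U' ∈ Matrix.unitaryGroup (Fin n) ℂ, ∃ V' ∈ Matrix.unitaryGroup (Fin n) ℂ,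
        V'ᴴ * A * V' = coordCompress g (U'ᴴ * B * U'))) ∧
    (∀ A B : Matrix (Fin n) (Fin n) ℂ, A.PosSemidef → B.PosSemidef →
      (∃ V ∈ Matrix.unitaryGroup (Fin n) ℂ, ∃ W : Matrix (Fin n) (Fin n) ℂ,
        IsContraction W ∧ Vᴴ * A * V = coordCompress g' (Wᴴ * B * W)) →
      (∃ V' ∈ Matrix.unitaryGroup (Fin n) ℂ, ∃ W' : Matrix (Fin n) (Fin n) ℂ,
        IsContraction W' ∧ V'ᴴ * A * V' = coordCompress g (W'ᴴ * B * W'))) := by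
  subst href
  have conj_mul (Y S R : Matrix (Fin n) (Fin n) ℂ) :
      (S * R)ᴴ * Y * (S * R) = Rᴴ * (Sᴴ * Y * S) * R := by
    simp only [Matrix.conjTranspose_mul, Matrix.mul_assoc]
  constructor
  · rintro A B hA - ⟨U, hU, V, hV, h⟩
    obtain ⟨R, hR, hRX⟩ := exists_unitary_conj_eq_coordCompress g f
      (Matrix.isHermitian_conjTranspose_mul_mul V hA) h
    refine ⟨U * R, mul_mem hU hR, V * R, mul_mem hV hR, ?_⟩
    rw [conj_mul, conj_mul, hRX]
  · rintro A B hA - ⟨V, hV, W, hW, h⟩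
    obtain ⟨R, hR, hRX⟩ := exists_unitary_conj_eq_coordCompress g f
      (Matrix.isHermitian_conjTranspose_mul_mul V hA.isHermitian) h
    refine ⟨V * R, mul_mem hV hR, W * R, hW.mul (isContraction_of_mem_unitaryGroup hR), ?_⟩
    rw [conj_mul, conj_mul, hRX]
end

section
/- Let f : [0,∞) → [0,∞) be a convex function with f(0) = 0 and let A, B ∈ M_n(ℂ) be positive semidefinite. Then there exist unitary matrices U, V ∈ U(n) such that U*f(A)U + V*f(B)V ≤ f(A+B) in the Loewner order. -/
open Matrix
open scoped ComplexOrder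

section FunctionalCalculus

variable {n : ℕ} {A : Matrix (Fin n) (Fin n) ℂ}

lemma matFun_id (hA : A.IsHermitian) : matFun hA (fun s => s) = A := by
  conv_rhs => rw [hA.spectral_theorem, Unitary.conjStarAlgAut_apply]
  rfl

lemma matFun_one (hA : A.IsHermitian) : matFun hA (fun _ => 1) = 1 := by
  simp [matFun]

lemma matFun_congr (hA : A.IsHermitian) {f g : ℝ → ℝ}
    (h : ∀ i, f (hA.eigenvalues i) = g (hA.eigenvalues i)) : matFun hA f = matFun hA g := by
  simp [matFun, h]

lemma matFun_mul (hA : A.IsHermitian) (f g : ℝ → ℝ) :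
    matFun hA f * matFun hA g = matFun hA (fun s => f s * g s) := by
  have h : star (hA.eigenvectorUnitary : Matrix (Fin n) (Fin n) ℂ) *
      (hA.eigenvectorUnitary : Matrix (Fin n) (Fin n) ℂ) = 1 := by simp
  calc _ = (hA.eigenvectorUnitary : Matrix (Fin n) (Fin n) ℂ) *
        diagonal (fun i => (f (hA.eigenvalues i) : ℂ)) *
        (star (hA.eigenvectorUnitary : Matrix (Fin n) (Fin n) ℂ) *
          (hA.eigenvectorUnitary : Matrix (Fin n) (Fin n) ℂ)) *
        diagonal (fun i => (g (hA.eigenvalues i) : ℂ)) *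
        star (hA.eigenvectorUnitary : Matrix (Fin n) (Fin n) ℂ) := by
        simp only [matFun, Matrix.mul_assoc]
    _ = _ := by
        rw [h, Matrix.mul_one, Matrix.mul_assoc _ (diagonal _) (diagonal _), diagonal_mul_diagonal]
        simp [matFun]

lemma matFun_sub (hA : A.IsHermitian) (f g : ℝ → ℝ) :
    matFun hA f - matFun hA g = matFun hA (fun s => f s - g s) := by
  simp [matFun, ← Matrix.sub_mul, ← Matrix.mul_sub, diagonal_sub]

lemma isHermitian_matFun (hA : A.IsHermitian) (f : ℝ → ℝ) : (matFun hA f).IsHermitian := by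
  rw [IsHermitian, matFun, star_eq_conjTranspose]
  simp only [conjTranspose_mul, conjTranspose_conjTranspose, diagonal_conjTranspose,
    Matrix.mul_assoc]
  congr 3
  ext i
  simp

lemma dotProduct_matFun_mulVec (hA : A.IsHermitian) (f : ℝ → ℝ) (x : Fin n → ℂ) :
    star x ⬝ᵥ (matFun hA f *ᵥ x) = ((∑ k, ‖(star (hA.eigenvectorUnitary :
      Matrix (Fin n) (Fin n) ℂ) *ᵥ x) k‖ ^ 2 * f (hA.eigenvalues k) : ℝ) : ℂ) := by
  have h : star x ᵥ* (hA.eigenvectorUnitary : Matrix (Fin n) (Fin n) ℂ) =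
      star (star (hA.eigenvectorUnitary : Matrix (Fin n) (Fin n) ℂ) *ᵥ x) := by
    rw [star_mulVec, star_eq_conjTranspose, conjTranspose_conjTranspose]
  rw [matFun, ← mulVec_mulVec, ← mulVec_mulVec, dotProduct_mulVec, h, dotProduct]
  push_cast
  refine Finset.sum_congr rfl fun k _ => ?_
  rw [mulVec_diagonal, Pi.star_apply, RCLike.star_def, mul_left_comm, Complex.conj_mul', mul_comm]

lemma posSemidef_matFun (hA : A.IsHermitian) {f : ℝ → ℝ}
    (hf : ∀ i, 0 ≤ f (hA.eigenvalues i)) : (matFun hA f).PosSemidef := by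
  refine .of_dotProduct_mulVec_nonneg (isHermitian_matFun hA f) fun x => ?_
  rw [dotProduct_matFun_mulVec, Complex.zero_le_real]
  exact Finset.sum_nonneg fun k _ => mul_nonneg (sq_nonneg _) (hf k)

lemma re_dotProduct_mulVec (hA : A.IsHermitian) (x : Fin n → ℂ) :
    (star x ⬝ᵥ (A *ᵥ x)).re = ∑ k, ‖(star (hA.eigenvectorUnitary :
      Matrix (Fin n) (Fin n) ℂ) *ᵥ x) k‖ ^ 2 * hA.eigenvalues k := by
  have h := dotProduct_matFun_mulVec hA (fun s => s) x
  rw [matFun_id] at h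
  rw [h, Complex.ofReal_re]

lemma re_dotProduct_self (hA : A.IsHermitian) (x : Fin n → ℂ) :
    (star x ⬝ᵥ x).re = ∑ k, ‖(star (hA.eigenvectorUnitary :
      Matrix (Fin n) (Fin n) ℂ) *ᵥ x) k‖ ^ 2 := by
  have h := dotProduct_matFun_mulVec hA (fun _ => 1) x
  rw [matFun_one, one_mulVec] at h
  rw [h, Complex.ofReal_re]
  simp

end FunctionalCalculus

section EigenvalueComparison

variable {n : ℕ} {A Y : Matrix (Fin n) (Fin n) ℂ}

/-- The eigenspaces of `A` for its largest eigenvalues and of `Y` for its smallest ones meet. -/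
lemma exists_ne_zero_eigenvalues_bound (hA : A.IsHermitian) (hY : Y.IsHermitian) (i : Fin n) :
    ∃ x : Fin n → ℂ, x ≠ 0 ∧
      hA.eigenvalues i * (star x ⬝ᵥ x).re ≤ (star x ⬝ᵥ (A *ᵥ x)).re ∧
      (star x ⬝ᵥ (Y *ᵥ x)).re ≤ hY.eigenvalues i * (star x ⬝ᵥ x).re := by
  let e : Fin n ≃ Fin (Fintype.card (Fin n)) :=
    (Fintype.equivOfCardEq (Fintype.card_fin _)).symm
  have anti : ∀ {M : Matrix (Fin n) (Fin n) ℂ} (hM : M.IsHermitian) {j k : Fin n}, e j ≤ e k →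
      hM.eigenvalues k ≤ hM.eigenvalues j := fun hM _ _ h => hM.eigenvalues₀_antitone h
  set L : Matrix (Fin n) (Fin n) ℂ := fun k =>
    if e i < e k then star (hA.eigenvectorUnitary : Matrix (Fin n) (Fin n) ℂ) k
    else if e k < e i then star (hY.eigenvectorUnitary : Matrix (Fin n) (Fin n) ℂ) k
    else 0 with hL
  have hnot : ¬ Function.Injective L.mulVecLin := by
    rw [LinearMap.injective_iff_surjective]
    intro hs
    obtain ⟨x, hx⟩ := hs (Pi.single i 1)
    have hLi : L i = 0 := by simp [hL]
    have := congrFun hx i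
    rw [mulVecLin_apply, mulVec, hLi, zero_dotProduct, Pi.single_eq_same] at this
    exact zero_ne_one this
  obtain ⟨x, hx, hx0⟩ : ∃ x, L *ᵥ x = 0 ∧ x ≠ 0 := by
    by_contra! h
    exact hnot ((injective_iff_map_eq_zero _).2 h)
  have hA0 : ∀ k, e i < e k →
      (star (hA.eigenvectorUnitary : Matrix (Fin n) (Fin n) ℂ) *ᵥ x) k = 0 := fun k hk => by
    have := congrFun hx k
    simpa [hL, mulVec, hk] using this
  have hY0 : ∀ k, e k < e i →
      (star (hY.eigenvectorUnitary : Matrix (Fin n) (Fin n) ℂ) *ᵥ x) k = 0 := fun k hk => by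
    have := congrFun hx k
    simpa [hL, mulVec, hk, hk.le.not_gt] using this
  refine ⟨x, hx0, ?_, ?_⟩
  · rw [re_dotProduct_self hA, re_dotProduct_mulVec hA, Finset.mul_sum]
    refine Finset.sum_le_sum fun k _ => ?_
    rw [mul_comm]
    rcases le_or_gt (e k) (e i) with hk | hk
    · exact mul_le_mul_of_nonneg_left (anti hA hk) (sq_nonneg _)
    · simp [hA0 k hk]
  · rw [re_dotProduct_self hY, re_dotProduct_mulVec hY, Finset.mul_sum]
    refine Finset.sum_le_sum fun k _ => ?_
    rw [mul_comm (hY.eigenvalues i)]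
    rcases le_or_gt (e i) (e k) with hk | hk
    · exact mul_le_mul_of_nonneg_left (anti hY hk) (sq_nonneg _)
    · simp [hY0 k hk]

lemma map_eigenvalues_le {f : ℝ → ℝ} (hf : MonotoneOn f (Set.Ici 0)) (hA : A.PosSemidef)
    (hY : Y.IsHermitian)
    (h : ∀ x : Fin n → ℂ, (star x ⬝ᵥ x).re = 1 →
      f (star x ⬝ᵥ (A *ᵥ x)).re ≤ (star x ⬝ᵥ (Y *ᵥ x)).re) (i : Fin n) :
    f (hA.1.eigenvalues i) ≤ hY.eigenvalues i := by
  obtain ⟨x, hx0, hxA, hxY⟩ := exists_ne_zero_eigenvalues_bound hA.1 hY i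
  have hpos : 0 < (star x ⬝ᵥ x).re :=
    (Complex.lt_def.1 (dotProduct_star_self_pos_iff.2 hx0)).1.trans_eq (by rw [dotProduct_comm])
  set c : ℝ := (√(star x ⬝ᵥ x).re)⁻¹ with hc
  have hcc : c * c * (star x ⬝ᵥ x).re = 1 := by
    rw [hc, ← mul_inv, Real.mul_self_sqrt hpos.le, inv_mul_cancel₀ hpos.ne']
  have hscale : ∀ z : Fin n → ℂ,
      (star ((c : ℂ) • x) ⬝ᵥ ((c : ℂ) • z)).re = c * c * (star x ⬝ᵥ z).re := fun z => by
    rw [star_smul, smul_dotProduct, dotProduct_smul, smul_smul, smul_eq_mul, RCLike.star_def,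
      Complex.conj_ofReal, ← Complex.ofReal_mul, Complex.re_ofReal_mul]
  have key := h ((c : ℂ) • x) (by rw [hscale, hcc])
  rw [mulVec_smul, mulVec_smul, hscale, hscale] at key
  have hcn : 0 ≤ c * c := mul_self_nonneg c
  have h1 : hA.1.eigenvalues i ≤ c * c * (star x ⬝ᵥ (A *ᵥ x)).re := by
    simpa only [mul_left_comm _ (hA.1.eigenvalues i), hcc, mul_one] using
      mul_le_mul_of_nonneg_left hxA hcn
  have h2 : c * c * (star x ⬝ᵥ (Y *ᵥ x)).re ≤ hY.eigenvalues i := by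
    simpa only [mul_left_comm _ (hY.eigenvalues i), hcc, mul_one] using
      mul_le_mul_of_nonneg_left hxY hcn
  have h0 := hA.eigenvalues_nonneg i
  exact ((hf h0 (h0.trans h1) h1).trans key).trans h2

lemma exists_unitary_conj_matFun_le (hA : A.IsHermitian) (hY : Y.IsHermitian) {f : ℝ → ℝ}
    (h : ∀ i, f (hA.eigenvalues i) ≤ hY.eigenvalues i) :
    ∃ U ∈ unitaryGroup (Fin n) ℂ, (Y - Uᴴ * matFun hA f * U).PosSemidef := by
  refine ⟨(hA.eigenvectorUnitary * star hY.eigenvectorUnitary : unitaryGroup (Fin n) ℂ),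
    Subtype.prop _, ?_⟩
  have hU : star (hA.eigenvectorUnitary : Matrix (Fin n) (Fin n) ℂ) *
      (hA.eigenvectorUnitary : Matrix (Fin n) (Fin n) ℂ) = 1 := by simp
  set W := (hY.eigenvectorUnitary : Matrix (Fin n) (Fin n) ℂ) with hW
  set U := (hA.eigenvectorUnitary : Matrix (Fin n) (Fin n) ℂ) with hUd
  have e1 : (U * star W)ᴴ * matFun hA f * (U * star W) =
      W * diagonal (fun i => (f (hA.eigenvalues i) : ℂ)) * Wᴴ := by
    calc _ = W * (star U * U) * diagonal (fun i => (f (hA.eigenvalues i) : ℂ)) *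
          (star U * U) * star W := by
          simp only [matFun, ← hUd, conjTranspose_mul, star_eq_conjTranspose,
            conjTranspose_conjTranspose, Matrix.mul_assoc]
      _ = _ := by rw [hU, Matrix.mul_one, Matrix.mul_one, star_eq_conjTranspose]
  have e2 : Y = W * diagonal (fun i => (hY.eigenvalues i : ℂ)) * Wᴴ := (matFun_id hY).symm
  have e3 : Y - (U * star W)ᴴ * matFun hA f * (U * star W) =
      W * diagonal (fun i => ((hY.eigenvalues i - f (hA.eigenvalues i) : ℝ) : ℂ)) * Wᴴ := by
    rw [e1]
    conv_lhs => rw [e2]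
    rw [← Matrix.sub_mul, ← Matrix.mul_sub, diagonal_sub]
    simp
  change (Y - (U * star W)ᴴ * matFun hA f * (U * star W)).PosSemidef
  rw [e3]
  refine PosSemidef.mul_mul_conjTranspose_same (PosSemidef.diagonal fun i => ?_) W
  exact Complex.zero_le_real.2 (sub_nonneg.2 (h i))

end EigenvalueComparison

section Convexity

variable {f : ℝ → ℝ}

lemma ConvexOn.monotoneOn_of_nonneg_of_map_zero (hf_nonneg : ∀ x : ℝ, 0 ≤ x → 0 ≤ f x)
    (hf : ConvexOn ℝ (Set.Ici 0) f) (hf0 : f 0 = 0) : MonotoneOn f (Set.Ici 0) := by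
  intro x hx y hy hxy
  rw [Set.mem_Ici] at hx hy
  rcases hy.eq_or_lt with rfl | hy0
  · rw [le_antisymm hxy hx]
  have h1 : x / y ≤ 1 := (div_le_one hy0).2 hxy
  have := hf.2 (Set.mem_Ici.2 hy) (Set.mem_Ici.2 le_rfl) (div_nonneg hx hy) (sub_nonneg.2 h1)
    (by ring)
  simp only [smul_eq_mul, mul_zero, add_zero, hf0, div_mul_cancel₀ x hy0.ne'] at this
  exact this.trans (mul_le_of_le_one_left (hf_nonneg y hy) h1)

lemma ConvexOn.map_sum_le_of_sum_le_one {ι : Type*} [Fintype ι] (hf : ConvexOn ℝ (Set.Ici 0) f)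
    (hf0 : f 0 = 0) {w s : ι → ℝ} (hw : ∀ i, 0 ≤ w i) (hw1 : ∑ i, w i ≤ 1) (hs : ∀ i, 0 ≤ s i) :
    f (∑ i, w i * s i) ≤ ∑ i, w i * f (s i) := by
  have := hf.map_add_sum_le (t := Finset.univ) (w := w) (p := s) (v := 1 - ∑ i, w i) (q := 0)
    (fun i _ => hw i) (by ring) (fun i _ => hs i) (sub_nonneg.2 hw1) (Set.mem_Ici.2 le_rfl)
  simpa [hf0] using this

end Convexity

section Contraction

variable {n : ℕ} {A S Z : Matrix (Fin n) (Fin n) ℂ}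

lemma posSemidef_one_sub_mul_conjTranspose (hZ : (1 - Zᴴ * Z).PosSemidef) :
    (1 - Z * Zᴴ).PosSemidef := by
  have h : 1 - Z * Zᴴ = (1 - Z * Zᴴ)ᴴ * (1 - Z * Zᴴ) + Z * (1 - Zᴴ * Z) * Zᴴ := by
    simp only [conjTranspose_sub, conjTranspose_one, conjTranspose_mul,
      conjTranspose_conjTranspose]
    noncomm_ring
  rw [h]
  exact (posSemidef_conjTranspose_mul_self _).add (hZ.mul_mul_conjTranspose_same Z)

/-- The Jensen inequality for a compression by a contraction. -/
lemma map_re_dotProduct_conj_le {f : ℝ → ℝ} (hf : ConvexOn ℝ (Set.Ici 0) f) (hf0 : f 0 = 0)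
    (hS : S.PosSemidef) (hZ : (1 - Zᴴ * Z).PosSemidef) (x : Fin n → ℂ)
    (hx : (star x ⬝ᵥ x).re = 1) :
    f (star x ⬝ᵥ ((Z * S * Zᴴ) *ᵥ x)).re ≤
      (star x ⬝ᵥ ((Z * matFun hS.1 f * Zᴴ) *ᵥ x)).re := by
  have hconj : ∀ M : Matrix (Fin n) (Fin n) ℂ,
      star x ⬝ᵥ ((Z * M * Zᴴ) *ᵥ x) = star (Zᴴ *ᵥ x) ⬝ᵥ (M *ᵥ (Zᴴ *ᵥ x)) := fun M => by
    rw [← mulVec_mulVec, ← mulVec_mulVec, dotProduct_mulVec, star_mulVec,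
      conjTranspose_conjTranspose]
  have hle : (star (Zᴴ *ᵥ x) ⬝ᵥ (Zᴴ *ᵥ x)).re ≤ 1 := by
    have h1 := (posSemidef_one_sub_mul_conjTranspose hZ).re_dotProduct_nonneg x
    have h2 := hconj 1
    rw [Matrix.mul_one, one_mulVec] at h2
    rw [sub_mulVec, one_mulVec, dotProduct_sub, h2, map_sub] at h1
    have h3 : RCLike.re (star x ⬝ᵥ x) = 1 := hx
    rw [h3] at h1
    exact sub_nonneg.1 h1
  rw [hconj, hconj, re_dotProduct_mulVec hS.1, dotProduct_matFun_mulVec, Complex.ofReal_re]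
  rw [re_dotProduct_self hS.1] at hle
  exact hf.map_sum_le_of_sum_le_one hf0 (fun _ => sq_nonneg _) hle hS.eigenvalues_nonneg

lemma exists_unitary_conj_matFun_le_of_contraction {f : ℝ → ℝ}
    (hf_nonneg : ∀ x : ℝ, 0 ≤ x → 0 ≤ f x) (hf : ConvexOn ℝ (Set.Ici 0) f) (hf0 : f 0 = 0)
    (hA : A.PosSemidef) (hS : S.PosSemidef) (hZ : (1 - Zᴴ * Z).PosSemidef)
    (hAZ : Z * S * Zᴴ = A) :
    ∃ U ∈ unitaryGroup (Fin n) ℂ,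
      (matFun hS.1 (fun s => √(f s)) * (Zᴴ * Z) * matFun hS.1 (fun s => √(f s)) -
        Uᴴ * matFun hA.1 f * U).PosSemidef := by
  set T := matFun hS.1 (fun s => √(f s)) with hT
  have hTh : Tᴴ = T := isHermitian_matFun _ _
  have hTT : T * T = matFun hS.1 f := by
    rw [hT, matFun_mul]
    exact matFun_congr _ fun i => Real.mul_self_sqrt (hf_nonneg _ (hS.eigenvalues_nonneg i))
  have e1 : Z * matFun hS.1 f * Zᴴ = (Z * T) * (Z * T)ᴴ := by
    rw [conjTranspose_mul, hTh, ← hTT]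
    simp only [Matrix.mul_assoc]
  have e2 : T * (Zᴴ * Z) * T = (Z * T)ᴴ * (Z * T) := by
    rw [conjTranspose_mul, hTh]
    simp only [Matrix.mul_assoc]
  have h1 := isHermitian_mul_conjTranspose_self (Z * T)
  have h2 := isHermitian_conjTranspose_mul_self (Z * T)
  rw [e2]
  refine exists_unitary_conj_matFun_le hA.1 h2 fun i => ?_
  rw [(h2.eigenvalues_eq_eigenvalues_iff h1).2 (charpoly_mul_comm _ _)]
  refine map_eigenvalues_le (hf.monotoneOn_of_nonneg_of_map_zero hf_nonneg hf0) hA h1 ?_ i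
  intro x hx
  rw [← e1, ← hAZ]
  exact map_re_dotProduct_conj_le hf hf0 hS hZ x hx

end Contraction

section Factorization

variable {n : ℕ} {A : Matrix (Fin n) (Fin n) ℂ}

/-- A Douglas-type factorization: if `0 ≤ A ≤ S`, then `A = Z S Z*`, where `Z* Z` is the
compression of `A` by the square root of the pseudo-inverse of `S`. -/
lemma exists_factorization_of_le {S : Matrix (Fin n) (Fin n) ℂ} (hA : A.PosSemidef)
    (hS : S.PosSemidef) (hAS : (S - A).PosSemidef) :
    ∃ Z : Matrix (Fin n) (Fin n) ℂ, Z * S * Zᴴ = A ∧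
      Zᴴ * Z = matFun hS.1 (fun s => (√s)⁻¹) * A * matFun hS.1 (fun s => (√s)⁻¹) := by
  set P := matFun hS.1 (fun s => (√s)⁻¹) with hP
  set R := matFun hA.1 (fun s => √s) with hR
  have hPh : Pᴴ = P := isHermitian_matFun _ _
  have hRh : Rᴴ = R := isHermitian_matFun _ _
  have hRR : R * R = A := by
    rw [hR, matFun_mul]
    refine (matFun_congr _ fun i => ?_).trans (matFun_id hA.1)
    exact Real.mul_self_sqrt (hA.eigenvalues_nonneg i)
  set N := matFun hS.1 (fun s => 1 - (√s)⁻¹ * s * (√s)⁻¹) with hN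
  have hNh : Nᴴ = N := isHermitian_matFun _ _
  have hPSP : P * S * P = 1 - N := by
    conv_lhs => rw [← matFun_id hS.1]
    rw [hP, matFun_mul, matFun_mul, hN, ← matFun_one hS.1, matFun_sub]
    simp
  have hNSN : N * S * N = 0 := by
    conv_lhs => rw [← matFun_id hS.1]
    rw [hN, matFun_mul, matFun_mul]
    rw [matFun_congr hS.1 (g := fun s => s - s), ← matFun_sub, sub_self]
    intro i
    have h0 := hS.eigenvalues_nonneg i
    rcases h0.eq_or_lt with h | h
    · simp [← h]
    · have h1 : √(hS.1.eigenvalues i) ≠ 0 := (Real.sqrt_pos.2 h).ne'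
      have h2 := Real.mul_self_sqrt h0
      have : (√(hS.1.eigenvalues i))⁻¹ * hS.1.eigenvalues i * (√(hS.1.eigenvalues i))⁻¹ = 1 := by
        field_simp
        nlinarith
      simp [this]
  have hNAN : N * A * N = 0 := by
    have h1 := hA.mul_mul_conjTranspose_same N
    have h2 := hAS.mul_mul_conjTranspose_same N
    rw [hNh] at h1 h2
    rw [Matrix.mul_sub, Matrix.sub_mul, hNSN] at h2
    open scoped MatrixOrder in
    exact le_antisymm (le_iff.2 h2) (nonneg_iff_posSemidef.2 h1)
  have hRN : R * N = 0 := by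
    rw [← conjTranspose_mul_self_eq_zero, conjTranspose_mul, hNh, hRh, ← hNAN, ← hRR]
    simp only [Matrix.mul_assoc]
  refine ⟨R * P, ?_, ?_⟩
  · rw [conjTranspose_mul, hPh, hRh]
    calc R * P * S * (P * R) = R * (P * S * P) * R := by simp only [Matrix.mul_assoc]
      _ = A := by rw [hPSP, Matrix.mul_sub, hRN, sub_zero, Matrix.mul_one, hRR]
  · rw [conjTranspose_mul, hPh, hRh, ← hRR]
    simp only [Matrix.mul_assoc]

end Factorization

/-- (Corollary: `U*f(A)U + V*f(B)V ≤ f(A+B)` in the Loewner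
order, for convex `f : [0,∞) → [0,∞)` with `f(0) = 0` and positive
semidefinite `A, B`). -/
theorem stmt_16 {n : ℕ} (f : ℝ → ℝ)
    (hf_nonneg : ∀ x : ℝ, 0 ≤ x → 0 ≤ f x)
    (hf_conv : ConvexOn ℝ (Set.Ici (0 : ℝ)) f) (hf0 : f 0 = 0)
    (A B : Matrix (Fin n) (Fin n) ℂ) (hA : A.PosSemidef) (hB : B.PosSemidef) :
    ∃ U ∈ Matrix.unitaryGroup (Fin n) ℂ, ∃ V ∈ Matrix.unitaryGroup (Fin n) ℂ,
      (matFun (hA.add hB).1 f -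
        (Uᴴ * matFun hA.1 f * U + Vᴴ * matFun hB.1 f * V)).PosSemidef := by
  have hS := hA.add hB
  obtain ⟨Z, hZ, hZZ⟩ := exists_factorization_of_le hA hS (by simpa using hB)
  obtain ⟨W, hW, hWW⟩ := exists_factorization_of_le hB hS (by simpa using hA)
  set P := matFun hS.1 (fun s => (√s)⁻¹) with hP
  have hPh : Pᴴ = P := isHermitian_matFun _ _
  have hPSP : (1 - P * (A + B) * P).PosSemidef := by
    have e : P * (A + B) * P = matFun hS.1 (fun s => (√s)⁻¹ * s * (√s)⁻¹) := by
      conv_lhs => rw [← matFun_id hS.1]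
      rw [hP, matFun_mul, matFun_mul]
    rw [e, ← matFun_one hS.1, matFun_sub]
    refine posSemidef_matFun _ fun i => ?_
    have h0 := hS.eigenvalues_nonneg i
    rw [sub_nonneg, mul_right_comm, ← mul_inv, Real.mul_self_sqrt h0]
    exact inv_mul_le_one
  have hsum : Zᴴ * Z + Wᴴ * W = P * (A + B) * P := by
    rw [hZZ, hWW, Matrix.mul_add, Matrix.add_mul]
  have hZc : (1 - Zᴴ * Z).PosSemidef := by
    have e : 1 - Zᴴ * Z = (1 - P * (A + B) * P) + Wᴴ * W := by rw [← hsum]; abel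
    exact e ▸ hPSP.add (posSemidef_conjTranspose_mul_self W)
  have hWc : (1 - Wᴴ * W).PosSemidef := by
    have e : 1 - Wᴴ * W = (1 - P * (A + B) * P) + Zᴴ * Z := by rw [← hsum]; abel
    exact e ▸ hPSP.add (posSemidef_conjTranspose_mul_self Z)
  obtain ⟨U, hU, hUle⟩ :=
    exists_unitary_conj_matFun_le_of_contraction hf_nonneg hf_conv hf0 hA hS hZc hZ
  obtain ⟨V, hV, hVle⟩ :=
    exists_unitary_conj_matFun_le_of_contraction hf_nonneg hf_conv hf0 hB hS hWc hW
  refine ⟨U, hU, V, hV, ?_⟩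
  set T := matFun hS.1 (fun s => √(f s)) with hT
  have hTh : Tᴴ = T := isHermitian_matFun _ _
  have hTT : T * T = matFun hS.1 f := by
    rw [hT, matFun_mul]
    exact matFun_congr _ fun i => Real.mul_self_sqrt (hf_nonneg _ (hS.eigenvalues_nonneg i))
  have hrest := hPSP.mul_mul_conjTranspose_same T
  rw [hTh, ← hsum] at hrest
  have e : matFun hS.1 f - (Uᴴ * matFun hA.1 f * U + Vᴴ * matFun hB.1 f * V) =
      T * (1 - (Zᴴ * Z + Wᴴ * W)) * T + (T * (Zᴴ * Z) * T - Uᴴ * matFun hA.1 f * U) +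
        (T * (Wᴴ * W) * T - Vᴴ * matFun hB.1 f * V) := by
    rw [← hTT, Matrix.mul_sub, Matrix.sub_mul, Matrix.mul_add, Matrix.add_mul, Matrix.mul_one]
    abel
  exact e ▸ (hrest.add hUle).add hVle
end
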